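/- Let g be a Lie algebra over k with multiloop data (m, σ, θ) as in the context. Then: (a) the derived algebra of L_m(g,σ,θ) (the k-span of all brackets of its elements) equals L_m(g', σ|_{g'}, θ), where g' = ⁅g,g⁆ is the derived algebra of g and σ|_{g'} is the n-tuple of restricted automorphisms; and (b) the centre of L_m(g,σ,θ) equals L_m(Z(g), σ|_{Z(g)}, θ), where Z(g) is the centre of g. Both equalities hold as subspaces of g ⊗_k S_n. -/

import Mathlib

open scoped TensorProduct

noncomputable section

/-- Laurent polynomials in `n` variables over `k`. -/
abbrev LaurentN (k : Type*) [Field k] (n : ℕ) : Type _ :=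
  AddMonoidAlgebra k (Fin n → ℤ)

instance lieAlgebraRestrictBaseChange (k : Type*) [Field k]
    (A : Type*) [CommRing A] [Algebra k A]
    (L : Type*) [LieRing L] [LieAlgebra k L] : LieAlgebra k (A ⊗[k] L) :=
  { (inferInstance : Module k (A ⊗[k] L)) with
    lie_smul := fun c x y => by
      rw [← algebraMap_smul A c y, lie_smul, algebraMap_smul] }

/-- The generating set `{z^κ ⊗ x : x ∈ g^κ}` of the multiloop algebra. -/
def multiloopGens (k : Type*) [Field k] (n : ℕ)
    (g : Type*) [LieRing g] [LieAlgebra k g]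
    (σ : Fin n → (g ≃ₗ[k] g)) (θ : Fin n → kˣ) : Set (LaurentN k n ⊗[k] g) :=
  {w | ∃ (κ : Fin n → ℤ) (x : g),
    (∀ i, σ i x = ((θ i ^ κ i : kˣ) : k) • x) ∧
    w = AddMonoidAlgebra.single κ (1 : k) ⊗ₜ[k] x}

/-- The multiloop algebra `L(g, σ, θ) = ⨁_κ g^κ ⊗ z^κ`, as a Lie subalgebra of `g ⊗ S_n`. -/
def multiloop (k : Type*) [Field k] (n : ℕ)
    (g : Type*) [LieRing g] [LieAlgebra k g]
    (σ : Fin n → (g ≃ₗ[k] g)) (θ : Fin n → kˣ) :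
    LieSubalgebra k (LaurentN k n ⊗[k] g) :=
  LieSubalgebra.lieSpan k _ (multiloopGens k n g σ θ)

section EigenProjection

variable {k g : Type*} [Field k] [AddCommGroup g] [Module k g]

/-- The averaging operator `m⁻¹ ∑_{j < m} t^{-j} f^j`: when `f ^ m = 1` and `t ^ m = 1`, this is
the projection onto the `t`-eigenspace of `f` along the other eigenspaces. -/
def eigenProj (f : Module.End k g) (m : ℕ) (t : kˣ) : Module.End k g :=
  (m : k)⁻¹ • ∑ j ∈ Finset.range m, ((t⁻¹ ^ j : kˣ) : k) • f ^ j

theorem eigenProj_apply (f : Module.End k g) (m : ℕ) (t : kˣ) (x : g) :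
    eigenProj f m t x =
      (m : k)⁻¹ • ∑ j ∈ Finset.range m, ((t⁻¹ ^ j : kˣ) : k) • (f ^ j) x := by
  simp [eigenProj, LinearMap.sum_apply]

theorem apply_eigenProj {f : Module.End k g} {m : ℕ} {t : kˣ} (hf : f ^ m = 1) (ht : t ^ m = 1)
    (x : g) : f (eigenProj f m t x) = (t : k) • eigenProj f m t x := by
  rw [eigenProj_apply, map_smul, smul_comm (t : k)]
  congr 1
  set h : ℕ → g := fun j => (t : k) • ((t⁻¹ ^ j : kˣ) : k) • (f ^ j) x with hh
  have h1 : f (∑ j ∈ Finset.range m, ((t⁻¹ ^ j : kˣ) : k) • (f ^ j) x)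
      = ∑ j ∈ Finset.range m, h (j + 1) := by
    rw [map_sum]
    refine Finset.sum_congr rfl fun j _ => ?_
    rw [hh, map_smul]
    dsimp only
    rw [smul_smul, ← Units.val_mul, pow_succ' t⁻¹, mul_inv_cancel_left, pow_succ' f]
    rfl
  have h2 : h m = h 0 := by simp only [hh, hf, inv_pow, ht, inv_one, pow_zero]
  rw [h1, Finset.smul_sum]
  have h3 := Finset.sum_range_succ h m
  rw [Finset.sum_range_succ', h2] at h3
  exact add_right_cancel h3

theorem commute_eigenProj {f e : Module.End k g} (h : Commute f e) (m : ℕ) (t : kˣ) :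
    Commute f (eigenProj e m t) :=
  (Commute.sum_right _ _ _ fun _ _ => (h.pow_right _).smul_right _).smul_right _

theorem pow_apply_of_apply_eq_smul {f : Module.End k g} {s : kˣ} {x : g}
    (hx : f x = (s : k) • x) (j : ℕ) : (f ^ j) x = ((s ^ j : kˣ) : k) • x := by
  induction j with
  | zero => simp
  | succ j ih =>
    rw [pow_succ', Module.End.mul_apply, ih, map_smul, hx, smul_smul, ← Units.val_mul, pow_succ]

theorem sum_range_pow_of_ne_one {q : kˣ} {m : ℕ} (hq : q ^ m = 1) (h1 : q ≠ 1) :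
    ∑ j ∈ Finset.range m, ((q ^ j : kˣ) : k) = 0 := by
  have h : (∑ j ∈ Finset.range m, (q : k) ^ j) * ((q : k) - 1) = 0 := by
    rw [geom_sum_mul, ← Units.val_pow_eq_pow_val, hq, Units.val_one, sub_self]
  simp only [Units.val_pow_eq_pow_val]
  refine (mul_eq_zero.1 h).resolve_right fun h' => h1 (Units.ext ?_)
  simpa using sub_eq_zero.1 h'

theorem eigenProj_apply_of_ne {f : Module.End k g} {m : ℕ} {s t : kˣ} (hs : s ^ m = 1)
    (ht : t ^ m = 1) (hne : s ≠ t) {x : g} (hx : f x = (s : k) • x) :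
    eigenProj f m t x = 0 := by
  have h := sum_range_pow_of_ne_one (q := t⁻¹ * s) (m := m) (by simp [mul_pow, hs, ht])
    (fun h => hne (by simpa using (inv_mul_eq_one.1 h).symm))
  simp only [eigenProj_apply, pow_apply_of_apply_eq_smul hx, smul_smul, ← Units.val_mul,
    ← mul_pow, ← Finset.sum_smul, h, zero_smul, smul_zero]

variable [CharZero k]

theorem eigenProj_apply_of_eq {f : Module.End k g} {m : ℕ} (hm : 0 < m) {t : kˣ} {x : g}
    (hx : f x = (t : k) • x) : eigenProj f m t x = x := by
  have hm' : (m : k) ≠ 0 := Nat.cast_ne_zero.2 hm.ne'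
  simp only [eigenProj_apply, pow_apply_of_apply_eq_smul hx, smul_smul, ← Units.val_mul,
    ← mul_pow, inv_mul_cancel, one_pow, Units.val_one, one_smul, Finset.sum_const,
    Finset.card_range]
  rw [← Nat.cast_smul_eq_nsmul k, smul_smul, inv_mul_cancel₀ hm', one_smul]

theorem sum_eigenProj (f : Module.End k g) {m : ℕ} (hm : 0 < m) {ζ : kˣ} (hζ : orderOf ζ = m)
    (x : g) : ∑ r ∈ Finset.range m, eigenProj f m (ζ ^ r) x = x := by
  have hm' : (m : k) ≠ 0 := Nat.cast_ne_zero.2 hm.ne'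
  have hswap (j r : ℕ) : ((ζ ^ r)⁻¹ ^ j : kˣ) = ((ζ ^ j)⁻¹) ^ r := by
    rw [inv_pow, inv_pow, ← pow_mul, ← pow_mul, mul_comm]
  have hproj (r : ℕ) : eigenProj f m (ζ ^ r) x =
      (m : k)⁻¹ • ∑ j ∈ Finset.range m, (((ζ ^ j)⁻¹ ^ r : kˣ) : k) • (f ^ j) x := by
    rw [eigenProj_apply]
    exact congrArg _ (Finset.sum_congr rfl fun j _ => by rw [hswap])
  simp_rw [hproj]
  rw [← Finset.smul_sum, Finset.sum_comm]
  simp_rw [← Finset.sum_smul]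
  rw [Finset.sum_eq_single_of_mem 0 (Finset.mem_range.2 hm)]
  · simp [smul_smul, hm']
  · intro j hj hj0
    rw [sum_range_pow_of_ne_one, zero_smul]
    · rw [inv_pow, ← pow_mul, mul_comm, pow_mul, ← hζ, pow_orderOf_eq_one, one_pow, inv_one]
    · rw [ne_eq, inv_eq_one]
      exact pow_ne_one_of_lt_orderOf hj0 (hζ ▸ Finset.mem_range.1 hj)

end EigenProjection

section Grading

variable {k : Type*} [Field k] {n : ℕ} {g : Type*} [LieRing g] [LieAlgebra k g]

/-- The simultaneous eigenspace `g^κ`. -/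
def gradedPiece (σ : Fin n → (g ≃ₗ[k] g)) (θ : Fin n → kˣ) (κ : Fin n → ℤ) : Submodule k g where
  carrier := {x | ∀ i, σ i x = ((θ i ^ κ i : kˣ) : k) • x}
  add_mem' hx hy i := by rw [map_add, hx i, hy i, smul_add]
  zero_mem' i := by rw [map_zero, smul_zero]
  smul_mem' c x hx i := by rw [map_smul, hx i, smul_comm]

variable {σ : Fin n → (g ≃ₗ[k] g)} {θ : Fin n → kˣ}

theorem lie_mem_gradedPiece (hσlie : ∀ i x y, σ i ⁅x, y⁆ = ⁅σ i x, σ i y⁆)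
    {κ μ : Fin n → ℤ} {x y : g} (hx : x ∈ gradedPiece σ θ κ) (hy : y ∈ gradedPiece σ θ μ) :
    ⁅x, y⁆ ∈ gradedPiece σ θ (κ + μ) := fun i => by
  rw [hσlie, hx i, hy i, smul_lie, lie_smul, smul_smul, ← Units.val_mul, ← zpow_add,
    Pi.add_apply]

theorem toLinearMap_pow_eq_one {e : g ≃ₗ[k] g} {m : ℕ} (h : e ^ m = 1) :
    (e.toLinearMap : Module.End k g) ^ m = 1 := by
  have := congrArg (LinearEquiv.automorphismGroup.toLinearMapMonoidHom (R := k) (M := g)) h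
  rwa [map_pow, map_one] at this

variable [CharZero k] {m : Fin n → ℕ}

theorem iSup_gradedPiece (hm : ∀ i, 0 < m i) (hσcomm : ∀ i j, Commute (σ i) (σ j))
    (hσord : ∀ i, σ i ^ m i = 1) (hθ : ∀ i, orderOf (θ i) = m i) :
    ⨆ κ, gradedPiece σ θ κ = ⊤ := by
  suffices H : ∀ s : Finset (Fin n), Submodule.span k {x : g | ∃ κ : Fin n → ℤ,
      ∀ i ∈ s, σ i x = ((θ i ^ κ i : kˣ) : k) • x} = ⊤ by
    rw [eq_top_iff, ← H Finset.univ, Submodule.span_le]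
    rintro x ⟨κ, hx⟩
    exact Submodule.mem_iSup_of_mem κ fun i => hx i (Finset.mem_univ i)
  intro s
  induction s using Finset.induction_on with
  | empty => simp
  | insert a s ha ih =>
    rw [eq_top_iff, ← ih, Submodule.span_le]
    rintro x ⟨κ, hx⟩
    rw [SetLike.mem_coe, ← sum_eigenProj (σ a).toLinearMap (hm a) (hθ a) x]
    refine Submodule.sum_mem _ fun r _ => Submodule.subset_span
      ⟨Function.update κ a r, fun i hi => ?_⟩
    rcases eq_or_ne i a with rfl | hia
    · rw [Function.update_self, zpow_natCast]
      refine apply_eigenProj (toLinearMap_pow_eq_one (hσord i)) ?_ x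
      rw [← zpow_natCast (θ i), ← hθ, zpow_pow_orderOf]
    · have hc : Commute ((σ i).toLinearMap : Module.End k g) (σ a).toLinearMap :=
        (hσcomm i a).map (LinearEquiv.automorphismGroup.toLinearMapMonoidHom (R := k) (M := g))
      rw [Function.update_of_ne hia]
      have h := LinearMap.congr_fun (commute_eigenProj hc (m a) (θ a ^ r)).eq x
      simp only [Module.End.mul_apply, LinearEquiv.coe_coe] at h
      rw [h, hx i (Finset.mem_of_mem_insert_of_ne hi hia), map_smul]

/-- The projection of `g` onto `g^κ`, as a product of eigenprojections. -/
def gradedProj (m : Fin n → ℕ) (σ : Fin n → (g ≃ₗ[k] g)) (θ : Fin n → kˣ) (κ : Fin n → ℤ) :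
    Module.End k g :=
  ((List.finRange n).map fun i => eigenProj (σ i).toLinearMap (m i) (θ i ^ κ i)).prod

theorem gradedProj_of_mem (hm : ∀ i, 0 < m i) {κ : Fin n → ℤ} {x : g}
    (hx : x ∈ gradedPiece σ θ κ) : gradedProj m σ θ κ x = x := by
  unfold gradedProj
  induction List.finRange n with
  | nil => rfl
  | cons a l ih =>
    rw [List.map_cons, List.prod_cons, Module.End.mul_apply, ih,
      eigenProj_apply_of_eq (hm a) (hx a)]

open scoped Classical in
theorem gradedProj_of_ne (hm : ∀ i, 0 < m i) (hθ : ∀ i, orderOf (θ i) = m i)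
    {κ μ : Fin n → ℤ} {x : g} (hx : x ∈ gradedPiece σ θ μ) {i : Fin n}
    (hne : θ i ^ μ i ≠ θ i ^ κ i) : gradedProj m σ θ κ x = 0 := by
  have key : ∀ l : List (Fin n),
      (l.map fun i => eigenProj (σ i).toLinearMap (m i) (θ i ^ κ i)).prod x =
        if ∀ i ∈ l, θ i ^ μ i = θ i ^ κ i then x else 0 := by
    intro l
    induction l with
    | nil => simp
    | cons a l ih =>
      rw [List.map_cons, List.prod_cons, Module.End.mul_apply, ih]
      by_cases hl : ∀ i ∈ l, θ i ^ μ i = θ i ^ κ i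
      · rw [if_pos hl]
        by_cases h : θ a ^ μ a = θ a ^ κ a
        · rw [eigenProj_apply_of_eq (hm a) (by rw [← h]; exact hx a), if_pos (by simpa [h])]
        · rw [eigenProj_apply_of_ne (hθ a ▸ zpow_pow_orderOf) (hθ a ▸ zpow_pow_orderOf)
            h (hx a), if_neg (by simp [h])]
      · rw [if_neg hl, map_zero, if_neg fun h => hl fun i hi => h i (List.mem_cons_of_mem a hi)]
  rw [gradedProj, key, if_neg fun h => hne (h i (List.mem_finRange i))]

end Grading

section Multiloop

theorem lie_mem_of_mem_span {R L : Type*} [CommRing R] [LieRing L] [LieAlgebra R L] {s : Set L}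
    {p : Submodule R L} (h : ∀ u ∈ s, ∀ v ∈ s, ⁅u, v⁆ ∈ p) {x y : L}
    (hx : x ∈ Submodule.span R s) (hy : y ∈ Submodule.span R s) : ⁅x, y⁆ ∈ p := by
  induction hx, hy using Submodule.span_induction₂ with
  | mem_mem u v hu hv => exact h u hu v hv
  | zero_left => simp
  | zero_right => simp
  | add_left _ _ _ _ _ _ h₁ h₂ => rw [add_lie]; exact add_mem h₁ h₂
  | add_right _ _ _ _ _ _ h₁ h₂ => rw [lie_add]; exact add_mem h₁ h₂
  | smul_left c _ _ _ _ h => rw [smul_lie]; exact Submodule.smul_mem _ c h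
  | smul_right c _ _ _ _ h => rw [lie_smul]; exact Submodule.smul_mem _ c h

variable {k : Type*} [Field k] {n : ℕ} {g : Type*} [LieRing g] [LieAlgebra k g]
  {σ : Fin n → (g ≃ₗ[k] g)} {θ : Fin n → kˣ}

theorem single_tmul_mem_multiloop {κ : Fin n → ℤ} {x : g} (hx : x ∈ gradedPiece σ θ κ) :
    AddMonoidAlgebra.single κ (1 : k) ⊗ₜ[k] x ∈ multiloop k n g σ θ :=
  LieSubalgebra.subset_lieSpan ⟨κ, x, hx, rfl⟩

theorem lie_single_tmul (κ μ : Fin n → ℤ) (x y : g) :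
    ⁅(AddMonoidAlgebra.single κ (1 : k) ⊗ₜ[k] x : LaurentN k n ⊗[k] g),
      (AddMonoidAlgebra.single μ (1 : k) ⊗ₜ[k] y : LaurentN k n ⊗[k] g)⁆ =
      AddMonoidAlgebra.single (κ + μ) (1 : k) ⊗ₜ[k] ⁅x, y⁆ := by
  rw [LieAlgebra.ExtendScalars.bracket_tmul, AddMonoidAlgebra.single_mul_single, mul_one]

theorem multiloop_toSubmodule (hσlie : ∀ i x y, σ i ⁅x, y⁆ = ⁅σ i x, σ i y⁆) :
    (multiloop k n g σ θ).toSubmodule = Submodule.span k (multiloopGens k n g σ θ) := by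
  refine le_antisymm ?_ (Submodule.span_le.2 LieSubalgebra.subset_lieSpan)
  let K : LieSubalgebra k (LaurentN k n ⊗[k] g) :=
    { Submodule.span k (multiloopGens k n g σ θ) with
      lie_mem' := by
        intro x y hx hy
        change ⁅x, y⁆ ∈ Submodule.span k (multiloopGens k n g σ θ)
        refine lie_mem_of_mem_span ?_ hx hy
        rintro _ ⟨κ, a, ha, rfl⟩ _ ⟨μ, b, hb, rfl⟩
        rw [lie_single_tmul]
        exact Submodule.subset_span ⟨_, _, lie_mem_gradedPiece hσlie ha hb, rfl⟩ }
  exact (LieSubalgebra.lieSpan_le (K := K)).2 Submodule.subset_span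

/-- The coefficient map `g ⊗ S_n → (ℤ^n →₀ g)`. -/
def tensorCoeff (k : Type*) [Field k] (n : ℕ) (g : Type*) [LieRing g] [LieAlgebra k g] :
    LaurentN k n ⊗[k] g ≃ₗ[k] ((Fin n → ℤ) →₀ g) :=
  (TensorProduct.congr (AddMonoidAlgebra.coeffLinearEquiv k) (LinearEquiv.refl k g)).trans
    (TensorProduct.finsuppScalarLeft k g (Fin n → ℤ))

theorem tensorCoeff_tmul_apply (p : LaurentN k n) (x : g) (κ : Fin n → ℤ) :
    tensorCoeff k n g (p ⊗ₜ[k] x) κ = p.coeff κ • x := by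
  simp [tensorCoeff, TensorProduct.finsuppScalarLeft_apply_tmul_apply]

theorem tensorCoeff_symm_single (κ : Fin n → ℤ) (x : g) :
    (tensorCoeff k n g).symm (Finsupp.single κ x) =
      AddMonoidAlgebra.single κ (1 : k) ⊗ₜ[k] x := by
  rw [LinearEquiv.symm_apply_eq]
  ext μ
  rw [tensorCoeff_tmul_apply, AddMonoidAlgebra.coeff_single, Finsupp.single_apply,
    Finsupp.single_apply]
  split_ifs <;> simp

theorem eq_sum_single_tmul (w : LaurentN k n ⊗[k] g) :
    w = ∑ κ ∈ (tensorCoeff k n g w).support,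
      AddMonoidAlgebra.single κ (1 : k) ⊗ₜ[k] tensorCoeff k n g w κ := by
  simp only [← tensorCoeff_symm_single, ← map_sum]
  rw [LinearEquiv.eq_symm_apply]
  exact (Finsupp.sum_single (tensorCoeff k n g w)).symm

theorem tensorCoeff_lie_single (w : LaurentN k n ⊗[k] g) (κ μ : Fin n → ℤ) (y : g) :
    tensorCoeff k n g ⁅w, (AddMonoidAlgebra.single μ (1 : k) ⊗ₜ[k] y : LaurentN k n ⊗[k] g)⁆
      (κ + μ) = ⁅tensorCoeff k n g w κ, y⁆ := by
  induction w using TensorProduct.induction_on with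
  | zero =>
    refine (congrArg (fun v => tensorCoeff k n g v (κ + μ)) (zero_lie _)).trans ?_
    simp
  | tmul p x =>
    rw [LieAlgebra.ExtendScalars.bracket_tmul, tensorCoeff_tmul_apply, tensorCoeff_tmul_apply,
      smul_lie]
    congr 1
    simp
  | add u v hu hv =>
    refine (congrArg (fun v => tensorCoeff k n g v (κ + μ)) (add_lie u v _)).trans ?_
    rw [map_add (tensorCoeff k n g), map_add (tensorCoeff k n g), Finsupp.add_apply, hu, hv,
      Finsupp.add_apply, add_lie]

theorem tensorCoeff_mem_gradedPiece (hσlie : ∀ i x y, σ i ⁅x, y⁆ = ⁅σ i x, σ i y⁆)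
    {w : LaurentN k n ⊗[k] g} (hw : w ∈ multiloop k n g σ θ) (κ : Fin n → ℤ) :
    tensorCoeff k n g w κ ∈ gradedPiece σ θ κ := by
  rw [← LieSubalgebra.mem_toSubmodule, multiloop_toSubmodule hσlie] at hw
  induction hw using Submodule.span_induction with
  | mem w hw =>
    obtain ⟨μ, x, hx, rfl⟩ := hw
    rw [tensorCoeff_tmul_apply, AddMonoidAlgebra.coeff_single, Finsupp.single_apply]
    split_ifs with h
    · subst h
      rw [one_smul]
      exact hx
    · rw [zero_smul]
      exact zero_mem _
  | zero => simp
  | add _ _ _ _ h₁ h₂ => rw [map_add]; exact add_mem h₁ h₂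
  | smul c _ _ h => rw [map_smul]; exact Submodule.smul_mem _ c h

variable [CharZero k] {m : Fin n → ℕ}

theorem single_tmul_gradedProj_lie_mem (hm : ∀ i, 0 < m i)
    (hσlie : ∀ i x y, σ i ⁅x, y⁆ = ⁅σ i x, σ i y⁆)
    (hσcomm : ∀ i j, Commute (σ i) (σ j)) (hσord : ∀ i, σ i ^ m i = 1)
    (hθ : ∀ i, orderOf (θ i) = m i) (κ : Fin n → ℤ) (a b : g) :
    AddMonoidAlgebra.single κ (1 : k) ⊗ₜ[k] gradedProj m σ θ κ ⁅a, b⁆ ∈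
      Submodule.span k {w : LaurentN k n ⊗[k] g |
        ∃ x ∈ multiloop k n g σ θ, ∃ y ∈ multiloop k n g σ θ, w = ⁅x, y⁆} := by
  have htop (x : g) : x ∈ ⨆ κ, gradedPiece σ θ κ := by
    rw [iSup_gradedPiece hm hσcomm hσord hθ]
    exact Submodule.mem_top
  induction htop a using Submodule.iSup_induction' with
  | zero => simp
  | add a₁ a₂ _ _ h₁ h₂ =>
    rw [add_lie, map_add, TensorProduct.tmul_add]
    exact add_mem h₁ h₂
  | mem μ a ha =>
    induction htop b using Submodule.iSup_induction' with
    | zero => simp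
    | add b₁ b₂ _ _ h₁ h₂ =>
      rw [lie_add, map_add, TensorProduct.tmul_add]
      exact add_mem h₁ h₂
    | mem ν b hb =>
      have hab := lie_mem_gradedPiece hσlie ha hb
      by_cases h : ∀ i, θ i ^ (μ + ν) i = θ i ^ κ i
      · have hab' : ⁅a, b⁆ ∈ gradedPiece σ θ κ := fun i => by rw [← h i]; exact hab i
        have hb' : b ∈ gradedPiece σ θ (κ - μ) := fun i => by
          rw [hb i, Pi.sub_apply, zpow_sub, ← h i, Pi.add_apply, zpow_add, mul_comm,
            inv_mul_cancel_left]
        rw [gradedProj_of_mem hm hab']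
        refine Submodule.subset_span ⟨_, single_tmul_mem_multiloop ha, _,
          single_tmul_mem_multiloop hb', ?_⟩
        rw [lie_single_tmul, add_sub_cancel]
      · obtain ⟨i, hi⟩ := not_forall.1 h
        rw [gradedProj_of_ne hm hθ hab hi, TensorProduct.tmul_zero]
        exact zero_mem _

end Multiloop

theorem statement5 (k : Type*) [Field k] [IsAlgClosed k] [CharZero k]
    (n : ℕ) (hn : 1 ≤ n) (g : Type*) [LieRing g] [LieAlgebra k g]
    (m : Fin n → ℕ) (hm : ∀ i, 0 < m i)
    (σ : Fin n → (g ≃ₗ[k] g))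
    (hσlie : ∀ i x y, σ i ⁅x, y⁆ = ⁅σ i x, σ i y⁆)
    (hσcomm : ∀ i j, Commute (σ i) (σ j))
    (hσord : ∀ i, σ i ^ m i = 1)
    (θ : Fin n → kˣ) (hθ : ∀ i, orderOf (θ i) = m i) :
    -- (a)  the derived algebra of `L_m(g,σ,θ)` equals `L_m(g', σ|_{g'}, θ)`
    (Submodule.span k {w : LaurentN k n ⊗[k] g |
        ∃ x ∈ multiloop k n g σ θ, ∃ y ∈ multiloop k n g σ θ, w = ⁅x, y⁆}
      = Submodule.span k {w : LaurentN k n ⊗[k] g | ∃ (κ : Fin n → ℤ) (x : g),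
          x ∈ (⁅(⊤ : LieIdeal k g), (⊤ : LieIdeal k g)⁆ : LieIdeal k g) ∧
          (∀ i, σ i x = ((θ i ^ κ i : kˣ) : k) • x) ∧
          w = AddMonoidAlgebra.single κ (1 : k) ⊗ₜ[k] x}) ∧
    -- (b)  the centre of `L_m(g,σ,θ)` equals `L_m(Z(g), σ|_{Z(g)}, θ)`
    ({w : LaurentN k n ⊗[k] g | w ∈ multiloop k n g σ θ ∧
        ∀ y ∈ multiloop k n g σ θ, ⁅w, y⁆ = 0}
      = (Submodule.span k {w : LaurentN k n ⊗[k] g | ∃ (κ : Fin n → ℤ) (x : g),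
          x ∈ LieAlgebra.center k g ∧
          (∀ i, σ i x = ((θ i ^ κ i : kˣ) : k) • x) ∧
          w = AddMonoidAlgebra.single κ (1 : k) ⊗ₜ[k] x} : Set (LaurentN k n ⊗[k] g))) := by
  have hgen : ∀ {κ : Fin n → ℤ} {x : g}, (∀ i, σ i x = ((θ i ^ κ i : kˣ) : k) • x) →
      x ∈ gradedPiece σ θ κ := fun h => h
  refine ⟨le_antisymm (Submodule.span_le.2 ?_) (Submodule.span_le.2 ?_), ?_⟩
  · rintro _ ⟨x, hx, y, hy, rfl⟩
    rw [← LieSubalgebra.mem_toSubmodule, multiloop_toSubmodule hσlie] at hx hy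
    rw [SetLike.mem_coe]
    refine lie_mem_of_mem_span ?_ hx hy
    rintro _ ⟨κ, a, ha, rfl⟩ _ ⟨μ, b, hb, rfl⟩
    rw [lie_single_tmul]
    exact Submodule.subset_span ⟨_, _, LieSubmodule.lie_mem_lie (LieSubmodule.mem_top a)
      (LieSubmodule.mem_top b), lie_mem_gradedPiece hσlie ha hb, rfl⟩
  · rintro _ ⟨κ, x, hx, hxκ, rfl⟩
    rw [SetLike.mem_coe, ← gradedProj_of_mem hm (hgen hxκ)]
    rw [← LieSubmodule.mem_toSubmodule, LieSubmodule.lieIdeal_oper_eq_linear_span'] at hx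
    clear hxκ
    induction hx using Submodule.span_induction with
    | mem x hx =>
      obtain ⟨a, -, b, -, rfl⟩ := hx
      exact single_tmul_gradedProj_lie_mem hm hσlie hσcomm hσord hθ κ a b
    | zero => simp
    | add _ _ _ _ h₁ h₂ => rw [map_add, TensorProduct.tmul_add]; exact add_mem h₁ h₂
    | smul c _ _ h =>
      rw [map_smul, TensorProduct.tmul_smul]
      exact Submodule.smul_mem _ c h
  · ext w
    constructor
    · rintro ⟨hw, hcomm⟩
      rw [SetLike.mem_coe, eq_sum_single_tmul w]
      refine Submodule.sum_mem _ fun κ _ => Submodule.subset_span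
        ⟨κ, _, ?_, tensorCoeff_mem_gradedPiece hσlie hw κ, rfl⟩
      have hz : ∀ y : g, ⁅tensorCoeff k n g w κ, y⁆ = 0 := by
        intro y
        have hy : y ∈ ⨆ κ, gradedPiece σ θ κ := by
          rw [iSup_gradedPiece hm hσcomm hσord hθ]
          exact Submodule.mem_top
        induction hy using Submodule.iSup_induction' with
        | zero => simp
        | add _ _ _ _ h₁ h₂ => rw [lie_add, h₁, h₂, add_zero]
        | mem μ y hy =>
          rw [← tensorCoeff_lie_single w κ μ y, hcomm _ (single_tmul_mem_multiloop hy), map_zero,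
            Finsupp.zero_apply]
      rw [LieModule.mem_maxTrivSubmodule]
      intro y
      rw [← lie_skew, hz, neg_zero]
    · intro hw
      rw [SetLike.mem_coe] at hw
      induction hw using Submodule.span_induction with
      | mem w hw =>
        obtain ⟨κ, x, hx, hxκ, rfl⟩ := hw
        refine ⟨single_tmul_mem_multiloop hxκ, fun y hy => ?_⟩
        clear hy
        induction y using TensorProduct.induction_on with
        | zero => exact lie_zero (AddMonoidAlgebra.single κ (1 : k) ⊗ₜ[k] x : LaurentN k n ⊗[k] g)
        | tmul p y =>
          rw [LieAlgebra.ExtendScalars.bracket_tmul, ← lie_skew,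
            (LieModule.mem_maxTrivSubmodule k g g x).1 hx y, neg_zero, TensorProduct.tmul_zero]
        | add u v hu hv =>
          exact (lie_add (AddMonoidAlgebra.single κ (1 : k) ⊗ₜ[k] x : LaurentN k n ⊗[k] g)
            u v).trans (by rw [hu, hv, add_zero])
      | zero => exact ⟨zero_mem _, fun y _ => zero_lie y⟩
      | add u v _ _ hu hv =>
        exact ⟨add_mem hu.1 hv.1, fun y hy =>
          (add_lie u v y).trans (by rw [hu.2 y hy, hv.2 y hy, add_zero])⟩
      | smul c u _ hu =>
        exact ⟨(multiloop k n g σ θ).smul_mem c hu.1, fun y hy =>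
          (smul_lie c u y).trans (by rw [hu.2 y hy, smul_zero])⟩
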